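/- arXiv:0705.4256 — 2 statements merged into one kernel-verified Lean document; each statement's English description precedes it below -/
import Mathlib

section
/- Let q be a prime power, F_q the finite field with q elements, and d a positive integer. Let A ⊆ F_q be a subset with |A| > q^(1/2 + 1/(2d)). Then every nonzero element of F_q lies in dA², i.e., F_q \ {0} ⊆ {a₁·a₁' + a₂·a₂' + ... + a_d·a_d' : a_i, a_i' ∈ A}. -/
lemma aux_fiber {G H : Type*} [AddGroup G] [AddGroup H] [Fintype G] [Fintype H] [DecidableEq H]
    (f : G →+ H) (hf : Function.Surjective f) (h : H) :
    Fintype.card H * (Finset.univ.filter (fun x => f x = h)).card = Fintype.card G := by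
  have h1 : ∀ b : H, (Finset.univ.filter (fun x => f x = b)).card
      = (Finset.univ.filter (fun x => f x = h)).card := by
    intro b
    obtain ⟨u, hu⟩ := hf (-b + h)
    apply Finset.card_bij (fun x _ => x + u)
    · intro x hx
      simp only [Finset.mem_filter, Finset.mem_univ, true_and] at hx ⊢
      rw [map_add, hx, hu]; simp
    · intro x _ y _ hxy
      simpa using hxy
    · intro y hy
      simp only [Finset.mem_filter, Finset.mem_univ, true_and] at hy
      refine ⟨y - u, ?_, by simp⟩
      simp only [Finset.mem_filter, Finset.mem_univ, true_and, map_sub, hy, hu]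
      simp [sub_eq_add_neg]
  have h2 := Finset.card_eq_sum_card_fiberwise (s := (Finset.univ : Finset G))
    (t := (Finset.univ : Finset H)) (f := f) (by intro x _; simp)
  simp only [h1, Finset.sum_const, Finset.card_univ, smul_eq_mul] at h2
  exact h2.symm

lemma aux_one {F : Type*} [Field F] [Fintype F] [DecidableEq F] {d : ℕ} (y : Fin d → F)
    (hy : y ≠ 0) (t : F) :
    Fintype.card F * (Finset.univ.filter (fun x : Fin d → F => ∑ i, x i * y i = t)).card
      = Fintype.card F ^ d := by
  obtain ⟨i, hi⟩ := Function.ne_iff.mp hy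
  simp only [Pi.zero_apply] at hi
  let f : (Fin d → F) →+ F :=
    { toFun := fun x => ∑ i, x i * y i
      map_zero' := by simp
      map_add' := by intro a b; simp [add_mul, Finset.sum_add_distrib] }
  have := aux_fiber f (by
    intro b
    refine ⟨Pi.single i (b / y i), ?_⟩
    simp [f, Pi.single_apply, hi]) t
  simpa [f] using this

lemma aux_two {F : Type*} [Field F] [Fintype F] [DecidableEq F] {d : ℕ} (y z : Fin d → F)
    (hy : y ≠ 0) (hyz : y ≠ z) (t : F) (ht : t ≠ 0) :
    Fintype.card F ^ 2 * (Finset.univ.filter (fun x : Fin d → F =>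
      ∑ i, x i * y i = t ∧ ∑ i, x i * z i = t)).card ≤ Fintype.card F ^ d := by
  by_cases hm : ∃ i j, y i * z j - y j * z i ≠ 0
  · obtain ⟨i, j, hij⟩ := hm
    let f : (Fin d → F) →+ F × F :=
      { toFun := fun x => (∑ i, x i * y i, ∑ i, x i * z i)
        map_zero' := by simp
        map_add' := by intro a b; simp [add_mul, Finset.sum_add_distrib] }
    have := aux_fiber f (by
      rintro ⟨b, c⟩
      refine ⟨Pi.single i ((b * z j - c * y j) / (y i * z j - y j * z i)) +
        Pi.single j ((c * y i - b * z i) / (y i * z j - y j * z i)), ?_⟩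
      simp only [f, AddMonoidHom.coe_mk, ZeroHom.coe_mk, Pi.add_apply, add_mul,
        Finset.sum_add_distrib, Pi.single_apply, ite_mul, zero_mul, Finset.sum_ite_eq',
        Finset.mem_univ, if_true, Prod.mk.injEq]
      constructor
      · rw [div_mul_eq_mul_div, div_mul_eq_mul_div, ← add_div, div_eq_iff hij]; ring
      · rw [div_mul_eq_mul_div, div_mul_eq_mul_div, ← add_div, div_eq_iff hij]; ring) (t, t)
    have h2 := this.le
    simpa [f, Prod.mk.injEq, sq] using h2
  · push Not at hm
    have he : (Finset.univ.filter (fun x : Fin d → F =>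
      ∑ i, x i * y i = t ∧ ∑ i, x i * z i = t)) = ∅ := by
      rw [Finset.filter_eq_empty_iff]
      rintro x - ⟨h1, h2⟩
      apply hyz
      funext i
      have h3 : y i * ∑ j, x j * z j = z i * ∑ j, x j * y j := by
        rw [Finset.mul_sum, Finset.mul_sum]
        refine Finset.sum_congr rfl fun j _ => ?_
        linear_combination x j * hm i j
      rw [h1, h2] at h3
      exact mul_right_cancel₀ ht h3
    rw [he]; simp

/-- If `A ⊆ F_q` with `|A| > q^(1/2 + 1/(2d))`, then every nonzero element of `F_q`
is a sum of `d` products of pairs of elements of `A`. -/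
theorem stmt_0 {F : Type*} [Field F] [Fintype F] (d : ℕ) (hd : 0 < d)
    (A : Finset F)
    (hA : (A.card : ℝ) > (Fintype.card F : ℝ) ^ ((1 : ℝ) / 2 + 1 / (2 * d))) :
    ∀ t : F, t ≠ 0 →
      ∃ a a' : Fin d → F, (∀ i, a i ∈ A) ∧ (∀ i, a' i ∈ A) ∧
        t = ∑ i, a i * a' i := by
  classical
  intro t ht
  by_contra hcon
  push Not at hcon
  set E : Finset (Fin d → F) := Fintype.piFinset (fun _ => A) with hE
  set E' := E.erase 0 with hE'
  set Q : ℝ := (Fintype.card F : ℝ) with hQ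
  have hQ1 : 1 ≤ Q := by
    rw [hQ]; exact_mod_cast Fintype.card_pos (α := F)
  have hQ0 : 0 < Q := by linarith
  set M : ℝ := (E.card : ℝ) with hM
  set N : ℝ := (E'.card : ℝ) with hN
  have hMA : M = (A.card : ℝ) ^ d := by simp [hM, hE]
  have hM2 : Q ^ (d + 1) < M ^ 2 := by
    have hd' : (d : ℝ) ≠ 0 := by positivity
    have h1 : (Q ^ ((1 : ℝ) / 2 + 1 / (2 * d))) ^ (d * 2) < (A.card : ℝ) ^ (d * 2) := by
      apply pow_lt_pow_left₀ hA (by positivity) (by positivity)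
    rw [← Real.rpow_natCast, ← Real.rpow_mul hQ0.le] at h1
    have h2 : ((1 : ℝ) / 2 + 1 / (2 * d)) * ((d * 2 : ℕ) : ℝ) = ((d + 1 : ℕ) : ℝ) := by
      push_cast; field_simp
    rw [h2, Real.rpow_natCast] at h1
    rw [hMA, ← pow_mul]; exact h1
  have hMP : M ≤ Q ^ d := by
    have : E.card ≤ Fintype.card (Fin d → F) := Finset.card_le_univ _
    simp only [Fintype.card_fun, Fintype.card_fin] at this
    rw [hM, hQ]; exact_mod_cast this
  have hNM : M - 1 ≤ N := by
    have := Finset.pred_card_le_card_erase (s := E) (a := 0)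
    have h2 : E.card ≤ E'.card + 1 := by rw [hE']; omega
    have h3 : M ≤ N + 1 := by rw [hM, hN]; exact_mod_cast h2
    linarith
  have hM1 : 1 < M := by
    have : (1 : ℝ) ≤ Q ^ (d + 1) := one_le_pow₀ hQ1
    have hM0 : 0 ≤ M := by positivity
    nlinarith
  have hN0 : 0 < N := by linarith
  set f : (Fin d → F) → ℝ := fun x => ∑ y ∈ E', if ∑ i, x i * y i = t then 1 else 0 with hf
  set P : ℝ := Q ^ d with hP
  have h1 : ∑ x, f x = N * (P / Q) := by
    rw [hf, Finset.sum_comm]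
    rw [Finset.sum_congr rfl (g := fun _ => P / Q), Finset.sum_const, nsmul_eq_mul]
    intro y hy
    have h := aux_one y (Finset.ne_of_mem_erase hy) t
    rw [Finset.sum_boole, eq_div_iff hQ0.ne', mul_comm, hP, hQ]
    exact_mod_cast h
  have h2 : ∑ x, f x ^ 2 ≤ N * (P / Q) + N * (N - 1) * (P / Q ^ 2) := by
    have e1 : ∑ x, f x ^ 2 = ∑ y ∈ E', ∑ z ∈ E', ∑ x : Fin d → F,
        (if ∑ i, x i * y i = t ∧ ∑ i, x i * z i = t then (1 : ℝ) else 0) := by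
      simp only [hf, sq, Finset.sum_mul_sum]
      rw [Finset.sum_comm]
      refine Finset.sum_congr rfl fun y _ => ?_
      rw [Finset.sum_comm]
      refine Finset.sum_congr rfl fun z _ => Finset.sum_congr rfl fun x _ => ?_
      by_cases h : ∑ i, x i * y i = t <;> by_cases h' : ∑ i, x i * z i = t <;> simp [h, h']
    rw [e1]
    have e2 : ∀ y ∈ E', ∑ z ∈ E', ∑ x : Fin d → F,
        (if ∑ i, x i * y i = t ∧ ∑ i, x i * z i = t then (1 : ℝ) else 0)
          ≤ P / Q + (N - 1) * (P / Q ^ 2) := by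
      intro y hy
      rw [← Finset.add_sum_erase _ _ hy]
      apply add_le_add
      · have h := aux_one y (Finset.ne_of_mem_erase hy) t
        simp only [and_self]
        rw [Finset.sum_boole, le_div_iff₀ hQ0, mul_comm, hP, hQ]
        exact_mod_cast h.le
      · have hc : (((E'.erase y).card : ℕ) : ℝ) = N - 1 := by
          rw [Finset.cast_card_erase_of_mem hy]
        rw [← hc, ← nsmul_eq_mul]
        apply Finset.sum_le_card_nsmul
        intro z hz
        have h := aux_two y z (Finset.ne_of_mem_erase hy) (Finset.ne_of_mem_erase hz).symm t ht
        rw [Finset.sum_boole, le_div_iff₀ (by positivity), mul_comm, hP, hQ]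
        exact_mod_cast h
    refine (Finset.sum_le_card_nsmul _ _ _ e2).trans (le_of_eq ?_)
    rw [nsmul_eq_mul]; ring
  have h3 : ∑ x, (f x - N / Q) ^ 2 ≤ N * (P / Q) - N * (P / Q ^ 2) := by
    have e : ∑ x, (f x - N / Q) ^ 2 = ∑ x, f x ^ 2 - 2 * (N / Q) * ∑ x, f x + P * (N / Q) ^ 2 := by
      have hc : P * (N / Q) ^ 2 = ∑ x : Fin d → F, (N / Q) ^ 2 := by
        simp [hP, hQ]
      rw [hc, Finset.mul_sum, ← Finset.sum_sub_distrib, ← Finset.sum_add_distrib]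
      refine Finset.sum_congr rfl fun x _ => by ring
    rw [e, h1]
    have : 2 * (N / Q) * (N * (P / Q)) = 2 * (N * N * (P / Q ^ 2)) := by field_simp
    have h' : P * (N / Q) ^ 2 = N * N * (P / Q ^ 2) := by field_simp
    rw [this, h']
    linarith
  have h4 : M * (N / Q) ^ 2 ≤ ∑ x, (f x - N / Q) ^ 2 := by
    have : ∑ x ∈ E, (f x - N / Q) ^ 2 = M * (N / Q) ^ 2 := by
      rw [Finset.sum_congr rfl (g := fun _ => (N / Q) ^ 2), Finset.sum_const, nsmul_eq_mul]
      intro x hx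
      have : f x = 0 := by
        apply Finset.sum_eq_zero
        intro y hy
        rw [if_neg]
        exact fun h => hcon x y (Fintype.mem_piFinset.mp hx)
          (Fintype.mem_piFinset.mp (Finset.mem_of_mem_erase hy)) h.symm
      rw [this]; ring
    rw [← this]
    exact Finset.sum_le_sum_of_subset_of_nonneg (Finset.subset_univ _) (fun _ _ _ => sq_nonneg _)
  have h5 := h4.trans h3
  have h6 : M * N ≤ P * Q - P := by
    have e1 : M * (N / Q) ^ 2 = (M * N) * (N / Q ^ 2) := by field_simp
    have e2 : N * (P / Q) - N * (P / Q ^ 2) = (P * Q - P) * (N / Q ^ 2) := by field_simp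
    rw [e1, e2] at h5
    exact le_of_mul_le_mul_right h5 (by positivity)
  have h7 : Q ^ (d + 1) = P * Q := by rw [hP, pow_succ]
  rw [h7] at hM2
  nlinarith
end

section
/- Let q be a prime power and F_q the finite field with q elements. If A ⊆ F_q satisfies |A| > q^(3/4), then every nonzero element of F_q lies in A² + A², i.e., F_q \ {0} ⊆ {a·b + c·e : a, b, c, e ∈ A}. -/
open Finset in
lemma aux_line {F : Type*} [Field F] [Fintype F] [DecidableEq F] (t : F) (y : F × F) (hy : y ≠ 0) :
    (univ.filter fun x : F × F => x.1 * y.1 + x.2 * y.2 = t).card = Fintype.card F := by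
  obtain ⟨y1, y2⟩ := y
  rw [← card_univ (α := F)]
  symm
  by_cases h1 : y1 = 0
  · have h2 : y2 ≠ 0 := by
      rintro rfl
      exact hy (by simp [h1])
    subst h1
    apply card_bij (fun u _ => (u, t / y2))
    · intro u _
      simp [div_mul_cancel₀ _ h2]
    · intro u _ v _ h
      simpa using h
    · rintro ⟨a, b⟩ h
      simp at h
      refine ⟨a, mem_univ _, ?_⟩
      simp [← h, h2]
  · apply card_bij (fun u _ => ((t - u * y2) / y1, u))
    · intro u _
      simp [div_mul_cancel₀ _ h1]
    · intro u _ v _ h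
      exact (Prod.mk.inj h).2
    · rintro ⟨a, b⟩ h
      simp at h
      refine ⟨b, mem_univ _, ?_⟩
      simp [← h, h1]

open Finset in
lemma aux_pair {F : Type*} [Field F] [Fintype F] [DecidableEq F] (t : F) (ht : t ≠ 0)
    (y z : F × F) (hyz : y ≠ z) :
    (univ.filter fun x : F × F => x.1 * y.1 + x.2 * y.2 = t ∧ x.1 * z.1 + x.2 * z.2 = t).card
      ≤ 1 := by
  rw [card_le_one]
  rintro ⟨a, b⟩ h ⟨c, d⟩ h'
  obtain ⟨y1, y2⟩ := y
  obtain ⟨z1, z2⟩ := z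
  simp only [mem_filter, mem_univ, true_and] at h h'
  obtain ⟨e1, e2⟩ := h
  obtain ⟨e3, e4⟩ := h'
  have hD : y1 * z2 - y2 * z1 ≠ 0 := by
    intro hD
    apply hyz
    have k1 : t * (y1 - z1) = 0 := by linear_combination -y1 * e2 + z1 * e1 + b * hD
    have k2 : t * (y2 - z2) = 0 := by linear_combination -y2 * e2 + z2 * e1 - a * hD
    have k1 := (mul_eq_zero.mp k1).resolve_left ht
    have k2 := (mul_eq_zero.mp k2).resolve_left ht
    rw [sub_eq_zero.mp k1, sub_eq_zero.mp k2]
  have k1 : (y1 * z2 - y2 * z1) * (a - c) = 0 := by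
    linear_combination z2 * (e1 - e3) - y2 * (e2 - e4)
  have k2 : (y1 * z2 - y2 * z1) * (b - d) = 0 := by
    linear_combination -z1 * (e1 - e3) + y1 * (e2 - e4)
  have k1 := (mul_eq_zero.mp k1).resolve_left hD
  have k2 := (mul_eq_zero.mp k2).resolve_left hD
  rw [sub_eq_zero.mp k1, sub_eq_zero.mp k2]

open Finset in
lemma aux_var {F : Type*} [Field F] [Fintype F] [DecidableEq F] (t : F) (ht : t ≠ 0)
    (E S : Finset (F × F)) (hS : ∀ y ∈ S, y ≠ 0)
    (h : ∀ x ∈ E, ∀ y ∈ S, x.1 * y.1 + x.2 * y.2 ≠ t) :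
    (E.card : ℤ) * (S.card : ℤ) ^ 2 ≤
      (Fintype.card F : ℤ) ^ 2 * S.card * ((Fintype.card F : ℤ) - 1) := by
  set q : ℤ := (Fintype.card F : ℤ) with hq
  set m : ℤ := (S.card : ℤ) with hm
  let N : F × F → ℤ := fun x => ∑ y ∈ S, if x.1 * y.1 + x.2 * y.2 = t then 1 else 0
  have hN1 : ∑ x, N x = q * m := by
    simp only [N]
    rw [sum_comm]
    rw [sum_congr rfl (g := fun _ => q)]
    · simp [hm, mul_comm]
    · intro y hy
      rw [sum_boole, aux_line t y (hS y hy)]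
  have hN2 : ∑ x, N x ^ 2 ≤ m * (q + (m - 1)) := by
    simp only [N, sq, sum_mul_sum]
    rw [sum_comm]
    have key : ∀ y ∈ S, ∑ x : F × F, ∑ z ∈ S, ((if x.1 * y.1 + x.2 * y.2 = t then (1:ℤ) else 0) *
        (if x.1 * z.1 + x.2 * z.2 = t then 1 else 0)) ≤ q + (m - 1) := by
      intro y hy
      rw [sum_comm, ← add_sum_erase _ _ hy]
      apply add_le_add
      · rw [← aux_line t y (hS y hy)] at hq
        rw [hq, ← sum_boole]
        apply le_of_eq
        apply sum_congr rfl
        intro x _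
        split_ifs <;> simp
      · have : ∀ z ∈ S.erase y, ∑ x : F × F, ((if x.1 * y.1 + x.2 * y.2 = t then (1:ℤ) else 0) *
            (if x.1 * z.1 + x.2 * z.2 = t then 1 else 0)) ≤ 1 := by
          intro z hz
          have h1 := aux_pair t ht y z (ne_of_mem_erase hz).symm
          have h2 : ((univ.filter fun x : F × F => x.1 * y.1 + x.2 * y.2 = t ∧
            x.1 * z.1 + x.2 * z.2 = t).card : ℤ) ≤ 1 := by exact_mod_cast h1
          rw [← sum_boole] at h2
          refine le_trans (le_of_eq (sum_congr rfl ?_)) h2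
          intro x _
          split_ifs <;> simp_all
        refine (sum_le_card_nsmul _ _ _ this).trans ?_
        rw [card_erase_of_mem hy]
        have : 1 ≤ S.card := card_pos.mpr ⟨y, hy⟩
        simp [hm, Nat.cast_sub this]
    refine (sum_le_card_nsmul _ _ _ key).trans ?_
    simp [hm]
  have hE : ∑ x ∈ E, (q * N x - m) ^ 2 = E.card * m ^ 2 := by
    rw [sum_congr rfl (g := fun _ => m ^ 2)]
    · simp
    · intro x hx
      have : N x = 0 := sum_eq_zero fun y hy => if_neg (h x hx y hy)
      rw [this]; ring
  have hle : ∑ x ∈ E, (q * N x - m) ^ 2 ≤ ∑ x, (q * N x - m) ^ 2 :=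
    sum_le_sum_of_subset_of_nonneg (subset_univ _) fun _ _ _ => sq_nonneg _
  have hexp : ∑ x, (q * N x - m) ^ 2 = q ^ 2 * ∑ x, N x ^ 2 - 2 * q * m * ∑ x, N x + q ^ 2 * m ^ 2 := by
    rw [mul_sum, mul_sum, ← sum_sub_distrib]
    have : q ^ 2 * m ^ 2 = ∑ x : F × F, m ^ 2 := by
      simp [hq, sq]
    rw [this, ← sum_add_distrib]
    apply sum_congr rfl
    intro x _
    ring
  rw [← hE]
  refine hle.trans ?_
  rw [hexp, hN1]
  have := mul_le_mul_of_nonneg_left hN2 (sq_nonneg q)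
  linarith

/-- If `A ⊆ F_q` with `|A| > q^(3/4)`, then every nonzero element of `F_q`
lies in `A² + A²`. -/
theorem stmt_2 {F : Type*} [Field F] [Fintype F] (A : Finset F)
    (hA : (A.card : ℝ) > (Fintype.card F : ℝ) ^ ((3 : ℝ) / 4)) :
    ∀ t : F, t ≠ 0 →
      ∃ a ∈ A, ∃ b ∈ A, ∃ c ∈ A, ∃ e ∈ A, t = a * b + c * e := by
  classical
  intro t ht
  by_contra hcon
  push Not at hcon
  have hpow : (Fintype.card F : ℤ) ^ 3 < (A.card : ℤ) ^ 4 := by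
    have h1 : ((Fintype.card F : ℝ) ^ ((3 : ℝ) / 4)) ^ 4 < (A.card : ℝ) ^ 4 :=
      pow_lt_pow_left₀ hA (by positivity) (by norm_num)
    rw [← Real.rpow_natCast, ← Real.rpow_mul (by positivity)] at h1
    have h2 : (3 : ℝ) / 4 * ((4 : ℕ) : ℝ) = ((3 : ℕ) : ℝ) := by norm_num
    rw [h2, Real.rpow_natCast] at h1
    exact_mod_cast h1
  have hq : (2 : ℤ) ≤ Fintype.card F := by
    exact_mod_cast Fintype.one_lt_card (α := F)
  have hle : (A.card : ℤ) ≤ Fintype.card F := by exact_mod_cast A.card_le_univ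
  have hv := aux_var t ht (A ×ˢ A) ((A ×ˢ A).erase 0) (fun y hy => Finset.ne_of_mem_erase hy) (by
    intro x hx y hy
    have hy := Finset.mem_of_mem_erase hy
    rw [Finset.mem_product] at hx hy
    exact (hcon _ hx.1 _ hy.1 _ hx.2 _ hy.2).symm)
  have hm : (A.card : ℤ) ^ 2 - 1 ≤ ((A ×ˢ A).erase 0).card := by
    have := Finset.pred_card_le_card_erase (s := A ×ˢ A) (a := (0 : F × F))
    rw [Finset.card_product] at this
    have h3 : A.card * A.card ≤ ((A ×ˢ A).erase 0).card + 1 := by omega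
    have h4 : (A.card : ℤ) * A.card ≤ ((A ×ˢ A).erase 0).card + 1 := by exact_mod_cast h3
    linarith [sq (A.card : ℤ)]
  rw [Finset.card_product] at hv
  push_cast at hv
  have hn0 : (0 : ℤ) ≤ A.card := by positivity
  generalize ((((A ×ˢ A).erase 0).card : ℕ) : ℤ) = m at *
  generalize (A.card : ℤ) = n at *
  generalize (Fintype.card F : ℤ) = q at *
  have hn2 : 2 ≤ n := by
    by_contra hlt
    have : n ^ 4 ≤ 1 ^ 4 := pow_le_pow_left₀ hn0 (by omega) 4
    have : (2 : ℤ) ^ 3 ≤ q ^ 3 := pow_le_pow_left₀ (by norm_num) hq 3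
    linarith
  have hmpos : 0 < m := by nlinarith
  have h5 : n * n * m ≤ q ^ 2 * (q - 1) := by
    apply le_of_mul_le_mul_right _ hmpos
    linarith
  have h6 : n ^ 2 * (n ^ 2 - 1) ≤ n ^ 2 * m := mul_le_mul_of_nonneg_left hm (sq_nonneg n)
  have h7 : n ^ 2 ≤ q ^ 2 := pow_le_pow_left₀ hn0 hle 2
  linarith
end
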